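/- arXiv:2502.08128 — 3 statements merged into one kernel-verified Lean document; each statement's English description precedes it below -/
import Mathlib

section
/- The family of spanning trees of K_n, viewed as (n-1)-element subsets of the edge set of K_n, is (n/2)-spread: for every set X of edges, the number of spanning trees containing X is at most (2/n)^{|X|} times n^{n-2}. -/
open Finset

/-- `f` is the parent function of a rooted tree with root `r`: the root is its own parent, and
every vertex reaches the root by passing to parents. -/
def IsParentMap {V : Type*} (f : V → V) (r : V) : Prop :=
  f r = r ∧ ∀ v, ∃ k, f^[k] v = r

namespace IsParentMap

variable {V : Type*} {f : V → V} {r : V}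

/-- A periodic point of a parent map is its root. -/
theorem eq_root_of_iterate_succ_eq (hf : IsParentMap f r) {v : V} {k : ℕ}
    (h : f^[k + 1] v = v) : v = r := by
  obtain ⟨j, hj⟩ := hf.2 v
  have hper : f^[(k + 1) * j] v = v := by
    rw [Function.iterate_mul]
    exact Function.iterate_fixed h j
  rw [show (k + 1) * j = k * j + j by ring, Function.iterate_add_apply, hj,
    Function.iterate_fixed hf.1] at hper
  exact hper.symm

theorem apply_eq_self_iff (hf : IsParentMap f r) {v : V} : f v = v ↔ v = r :=
  ⟨fun h => hf.eq_root_of_iterate_succ_eq (k := 0) h, fun h => h ▸ hf.1⟩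

end IsParentMap

section Count

variable {V : Type*} [Fintype V] [DecidableEq V]

open Classical in
/-- The parent maps that agree with `g` on `S`. -/
noncomputable def parentMapsExtending (g : V → V) (S : Finset V) : Finset (V → V) :=
  {f | (∃ r, IsParentMap f r) ∧ ∀ x ∈ S, f x = g x}

theorem mem_parentMapsExtending {g f : V → V} {S : Finset V} :
    f ∈ parentMapsExtending g S ↔ (∃ r, IsParentMap f r) ∧ ∀ x ∈ S, f x = g x := by
  simp [parentMapsExtending]

/-- If a set `S` avoids the root of a parent map `g`, then following `g` from `v` leads to a vertex
outside `S` to which no parent map agreeing with `g` on `S` can assign the parent `v`. -/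
theorem exists_notMem_forall_parent_ne {g : V → V} {r : V} (hg : IsParentMap g r) {S : Finset V}
    (hr : r ∉ S) (v : V) :
    ∃ u ∉ S, ∀ f ∈ parentMapsExtending g S, f u = v → f u = u := by
  have hex : ∃ k, g^[k] v ∉ S := by
    obtain ⟨k, hk⟩ := hg.2 v
    exact ⟨k, hk ▸ hr⟩
  refine ⟨g^[Nat.find hex] v, Nat.find_spec hex, fun f hf hfv => ?_⟩
  obtain ⟨⟨s, hs⟩, hfg⟩ := mem_parentMapsExtending.1 hf
  have hiter : ∀ j ≤ Nat.find hex, f^[j] v = g^[j] v := by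
    intro j
    induction j with
    | zero => simp
    | succ j ih =>
      intro hj
      rw [Function.iterate_succ_apply', Function.iterate_succ_apply', ih (by omega)]
      exact hfg _ (not_not.1 (Nat.find_min hex (by omega)))
  rw [← hiter _ le_rfl] at hfv ⊢
  have hv : v = s :=
    hs.eq_root_of_iterate_succ_eq (k := Nat.find hex) (by
      rw [Function.iterate_succ_apply', hfv])
  have hfix : ∀ k, f^[k] v = s := fun k => by rw [hv, Function.iterate_fixed hs.1]
  rw [hfix, hs.1]

/-- A parent map on `|S| + 1 + m` vertices has at most `(|S| + 1 + m) ^ m` modifications that are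
parent maps and agree with it on the set `S` of non-root vertices. -/
theorem card_parentMapsExtending_le (m : ℕ) {g : V → V} {r : V} (hg : IsParentMap g r)
    {S : Finset V} (hr : r ∉ S) (hS : Fintype.card V = #S + 1 + m) :
    #(parentMapsExtending g S) ≤ Fintype.card V ^ m := by
  induction m generalizing g r S with
  | zero =>
    rw [pow_zero, ← card_singleton g]
    refine card_le_card fun f hf => ?_
    obtain ⟨⟨s, hs⟩, hfg⟩ := mem_parentMapsExtending.1 hf
    have huniv : insert r S = univ := by
      rw [← card_eq_iff_eq_univ, card_insert_of_notMem hr, hS]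
    have hcover : ∀ x, x = r ∨ x ∈ S := fun x => by
      rw [← mem_insert, huniv]
      exact mem_univ x
    have hsr : s = r := (hcover s).resolve_right fun hsS =>
      hr (by rwa [← hg.apply_eq_self_iff.1 ((hfg s hsS).symm.trans hs.1)])
    rw [mem_singleton]
    funext x
    rcases hcover x with rfl | hx
    · rw [hg.1, ← hsr, hs.1]
    · exact hfg x hx
  | succ m ih =>
    set A := parentMapsExtending g S
    have hfiber : ∀ f ∈ A, #{u ∈ Sᶜ | f u ≠ u} = m + 1 := by
      intro f hf
      obtain ⟨⟨s, hs⟩, hfg⟩ := mem_parentMapsExtending.1 hf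
      have hsS : s ∉ S := fun hsS =>
        hr (by rwa [← hg.apply_eq_self_iff.1 ((hfg s hsS).symm.trans hs.1)])
      have : {u ∈ Sᶜ | f u ≠ u} = Sᶜ.erase s := by
        ext u
        simp [hs.apply_eq_self_iff, and_comm]
      rw [this, card_erase_of_mem (by simpa using hsS), card_compl]
      omega
    have hedge : ∀ v, ∀ u ∈ Sᶜ, #{f ∈ A | f u ≠ u ∧ f u = v} ≤ Fintype.card V ^ m := by
      intro v u hu
      rcases eq_empty_or_nonempty {f ∈ A | f u ≠ u ∧ f u = v} with he | ⟨f₁, hf₁⟩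
      · rw [he]; simp
      obtain ⟨hf₁A, hne, rfl⟩ := mem_filter.1 hf₁
      obtain ⟨⟨s, hs⟩, hfg⟩ := mem_parentMapsExtending.1 hf₁A
      have hu' : u ∉ S := by simpa using hu
      refine le_trans (card_le_card ?_) (ih hs (S := insert u S) ?_ ?_)
      · intro f hf
        obtain ⟨hfA, -, hfu⟩ := mem_filter.1 hf
        obtain ⟨hroot, hfg'⟩ := mem_parentMapsExtending.1 hfA
        refine mem_parentMapsExtending.2 ⟨hroot, fun x hx => ?_⟩
        rcases mem_insert.1 hx with rfl | hx
        · exact hfu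
        · rw [hfg' x hx, hfg x hx]
      · rw [mem_insert, not_or]
        refine ⟨fun h => hne (h ▸ hs.1), fun hsS => hr ?_⟩
        rwa [← hg.apply_eq_self_iff.1 ((hfg s hsS).symm.trans hs.1)]
      · rw [card_insert_of_notMem hu']; omega
    have hvertex : ∀ v, ∑ u ∈ Sᶜ, #{f ∈ A | f u ≠ u ∧ f u = v} ≤
        (m + 1) * Fintype.card V ^ m := by
      intro v
      obtain ⟨w, hwS, hw⟩ := exists_notMem_forall_parent_ne hg hr v
      have hwS' : w ∈ Sᶜ := by simpa using hwS
      have hzero : #{f ∈ A | f w ≠ w ∧ f w = v} = 0 := by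
        rw [card_eq_zero, filter_eq_empty_iff]
        exact fun f hf h => h.1 (hw f hf h.2)
      rw [← add_sum_erase _ _ hwS', hzero, zero_add]
      refine (sum_le_card_nsmul _ _ _ fun u hu => hedge v u (mem_of_mem_erase hu)).trans_eq ?_
      rw [card_erase_of_mem hwS', card_compl, smul_eq_mul, hS]
      congr 1
      omega
    have hdouble : (m + 1) * #A = ∑ v, ∑ u ∈ Sᶜ, #{f ∈ A | f u ≠ u ∧ f u = v} := by
      calc (m + 1) * #A = ∑ f ∈ A, #{u ∈ Sᶜ | f u ≠ u} := by
            rw [sum_congr rfl hfiber, sum_const, smul_eq_mul, mul_comm]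
        _ = ∑ u ∈ Sᶜ, #{f ∈ A | f u ≠ u} := by
            simp only [card_filter]
            exact sum_comm
        _ = ∑ u ∈ Sᶜ, ∑ v, #{f ∈ A | f u ≠ u ∧ f u = v} := by
            refine sum_congr rfl fun u _ => ?_
            rw [card_eq_sum_card_fiberwise (f := fun f => f u) (t := univ) (by simp)]
            simp only [filter_filter]
        _ = _ := sum_comm
    have hle : (m + 1) * #A ≤ (m + 1) * Fintype.card V ^ (m + 1) := by
      rw [hdouble]
      refine (sum_le_card_nsmul _ _ _ fun v _ => hvertex v).trans_eq ?_
      rw [card_univ, smul_eq_mul]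
      ring
    exact Nat.le_of_mul_le_mul_left hle (Nat.succ_pos m)

open Classical in
/-- The parent maps whose underlying tree contains all edges in `X`. -/
noncomputable def parentMapsContaining (X : Finset (Sym2 V)) : Finset (V → V) :=
  {f | (∃ r, IsParentMap f r) ∧ ∀ e ∈ X, ∃ u, f u ≠ u ∧ s(u, f u) = e}

/-- Parent maps for which the edges in `X` have prescribed lower endpoints `σ`. -/
theorem card_filter_orientation_mul_le (X : Finset (Sym2 V)) (σ : X → V) :
    #{f ∈ parentMapsContaining X | ∀ e : X, f (σ e) ≠ σ e ∧ s(σ e, f (σ e)) = e} *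
      Fintype.card V ^ (#X + 1) ≤ Fintype.card V ^ Fintype.card V := by
  set B := {f ∈ parentMapsContaining X | ∀ e : X, f (σ e) ≠ σ e ∧ s(σ e, f (σ e)) = e}
  rcases B.eq_empty_or_nonempty with he | ⟨g, hgB⟩
  · simp [he]
  have hparent : ∀ f ∈ B, ∃ r, IsParentMap f r := fun f hf => by
    have := (mem_filter.1 hf).1
    simp only [parentMapsContaining, mem_filter_univ] at this
    exact this.1
  obtain ⟨r, hg⟩ := hparent g hgB
  have hσ := (mem_filter.1 hgB).2
  have hinj : Function.Injective σ := fun e e' h => by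
    apply Subtype.ext
    rw [← (hσ e).2, ← (hσ e').2, h]
  have hcard : #(univ.image σ) = #X := by
    rw [card_image_of_injective _ hinj, card_univ, Fintype.card_coe]
  have hr : r ∉ univ.image σ := by
    simp only [mem_image, mem_univ, true_and, not_exists]
    exact fun e he => (hσ e).1 (he ▸ hg.1)
  have hlt : #X + 1 ≤ Fintype.card V := by
    rw [← hcard, ← card_insert_of_notMem hr]
    exact card_le_univ _
  have hsub : B ⊆ parentMapsExtending g (univ.image σ) := fun f hf => by
    refine mem_parentMapsExtending.2 ⟨hparent f hf, fun x hx => ?_⟩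
    obtain ⟨e, -, rfl⟩ := mem_image.1 hx
    exact Sym2.congr_right.1 ((((mem_filter.1 hf).2 e).2).trans (hσ e).2.symm)
  have hle := (card_le_card hsub).trans
    (card_parentMapsExtending_le (Fintype.card V - (#X + 1)) hg hr (by omega))
  calc #B * Fintype.card V ^ (#X + 1)
      ≤ Fintype.card V ^ (Fintype.card V - (#X + 1)) * Fintype.card V ^ (#X + 1) := by gcongr
    _ = _ := by rw [← pow_add, Nat.sub_add_cancel hlt]

theorem card_parentMapsContaining_mul_le (X : Finset (Sym2 V)) :
    #(parentMapsContaining X) * Fintype.card V ^ (#X + 1) ≤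
      2 ^ #X * Fintype.card V ^ Fintype.card V := by
  set O : Finset (X → V) := Fintype.piFinset fun e : X => (e : Sym2 V).toFinset with hO
  have hcover : parentMapsContaining X ⊆ O.biUnion fun σ =>
      {f ∈ parentMapsContaining X | ∀ e : X, f (σ e) ≠ σ e ∧ s(σ e, f (σ e)) = e} := by
    intro f hf
    have hf' := hf
    simp only [parentMapsContaining, mem_filter_univ] at hf'
    choose σ hσ using fun e : X => hf'.2 e e.2
    refine mem_biUnion.2 ⟨σ, Fintype.mem_piFinset.2 fun e => ?_, mem_filter.2 ⟨hf, hσ⟩⟩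
    rw [Sym2.mem_toFinset, ← (hσ e).2]
    exact Sym2.mem_mk_left _ _
  have hO_card : #O ≤ 2 ^ #X := by
    rw [hO, Fintype.card_piFinset]
    refine (prod_le_pow_card _ _ 2 fun e _ => ?_).trans_eq (by simp)
    rw [Sym2.card_toFinset]
    split_ifs <;> omega
  calc #(parentMapsContaining X) * Fintype.card V ^ (#X + 1)
      ≤ (∑ σ ∈ O, #{f ∈ parentMapsContaining X |
          ∀ e : X, f (σ e) ≠ σ e ∧ s(σ e, f (σ e)) = e}) * Fintype.card V ^ (#X + 1) := by
        gcongr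
        exact (card_le_card hcover).trans card_biUnion_le
    _ ≤ #O * Fintype.card V ^ Fintype.card V := by
        rw [sum_mul]
        exact sum_le_card_nsmul _ _ _ fun σ _ => card_filter_orientation_mul_le X σ
    _ ≤ _ := by gcongr

end Count

namespace SimpleGraph

variable {V : Type*}

/-- In a connected graph, every vertex other than `r` has a neighbour closer to `r`. -/
theorem Connected.exists_adj_dist_add_one_eq {G : SimpleGraph V} (hG : G.Connected) {v r : V}
    (h : v ≠ r) : ∃ w, G.Adj v w ∧ G.dist w r + 1 = G.dist v r := by
  obtain ⟨p, hp⟩ := hG.exists_walk_length_eq_dist v r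
  cases p with
  | nil => exact absurd rfl h
  | @cons _ w _ hadj q =>
    refine ⟨w, hadj, ?_⟩
    have h₁ : G.dist w r ≤ q.length := dist_le q
    have h₂ : G.dist v r ≤ G.dist v w + G.dist w r := hG.dist_triangle
    rw [dist_eq_one_iff_adj.2 hadj] at h₂
    rw [Walk.length_cons] at hp
    omega

variable [Fintype V]

/-- Every tree with a chosen root has a parent map, whose edges are exactly those of the tree. -/
theorem IsTree.exists_isParentMap {T : SimpleGraph V} (hT : T.IsTree) (r : V) :
    ∃ f : V → V, IsParentMap f r ∧ ∀ e, e ∈ T.edgeSet ↔ ∃ u, f u ≠ u ∧ s(u, f u) = e := by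
  classical
  have hex : ∀ v, ∃ w, (v = r → w = r) ∧
      (v ≠ r → T.Adj v w ∧ T.dist w r + 1 = T.dist v r) := fun v => by
    by_cases h : v = r
    · exact ⟨r, fun _ => rfl, fun h' => absurd h h'⟩
    · obtain ⟨w, hw⟩ := hT.connected.exists_adj_dist_add_one_eq h
      exact ⟨w, fun h' => absurd h' h, fun _ => hw⟩
  choose f hroot hne using hex
  have hf : IsParentMap f r := by
    refine ⟨hroot r rfl, fun v => ?_⟩
    induction hd : T.dist v r using Nat.strong_induction_on generalizing v with
    | _ d ih =>
      by_cases h : v = r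
      · exact ⟨0, h⟩
      · obtain ⟨k, hk⟩ := ih (T.dist (f v) r) (by have := (hne v h).2; omega) (f v) rfl
        exact ⟨k + 1, hk⟩
  have hinj : Set.InjOn (fun u => s(u, f u)) (univ.erase r : Finset V) := by
    intro u hu w hw huw
    have hu' := (hne u (by simpa using hu)).2
    have hw' := (hne w (by simpa using hw)).2
    rcases Sym2.eq_iff.1 huw with h | ⟨h₁, h₂⟩
    · exact h.1
    · rw [h₂] at hu'
      rw [← h₁] at hw'
      omega
  have himage : (univ.erase r).image (fun u => s(u, f u)) = T.edgeFinset := by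
    refine eq_of_subset_of_card_le ?_ ?_
    · intro e he
      obtain ⟨u, hu, rfl⟩ := mem_image.1 he
      exact mem_edgeFinset.2 (hne u (by simpa using hu)).1
    · rw [card_image_of_injOn hinj, card_erase_of_mem (mem_univ r), card_univ,
        ← hT.card_edgeFinset, Nat.add_sub_cancel]
  refine ⟨f, hf, fun e => ?_⟩
  rw [← mem_edgeFinset, ← himage]
  simp [hf.apply_eq_self_iff]

/-- Choosing a root turns each spanning tree containing `X` into `|V|` distinct parent maps. -/
theorem card_trees_mul_card_le [DecidableEq V] (X : Finset (Sym2 V)) :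
    Nat.card {T : SimpleGraph V // T.IsTree ∧ (X : Set (Sym2 V)) ⊆ T.edgeSet} * Fintype.card V ≤
      #(parentMapsContaining X) := by
  choose f hf hedge using
    fun p : {T : SimpleGraph V // T.IsTree ∧ (X : Set (Sym2 V)) ⊆ T.edgeSet} × V =>
      p.1.2.1.exists_isParentMap p.2
  have hmem : ∀ p, f p ∈ parentMapsContaining X := fun p => by
    simp only [parentMapsContaining, mem_filter_univ]
    exact ⟨⟨_, hf p⟩, fun e he => (hedge p e).1 (p.1.2.2 he)⟩
  have hinj : Function.Injective fun p => (⟨f p, hmem p⟩ : parentMapsContaining X) := by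
    intro p q hpq
    have h : f p = f q := congrArg Subtype.val hpq
    refine Prod.ext (Subtype.ext (edgeSet_injective (Set.ext fun e => ?_))) ?_
    · rw [hedge, hedge, h]
    · exact (hf q).apply_eq_self_iff.1 (h ▸ (hf p).1)
  have := Nat.card_le_card_of_injective _ hinj
  simpa [Nat.card_prod] using this

end SimpleGraph

/-- The family of spanning trees of `K_n`, viewed as sets of edges, is `(n/2)`-spread:
for every set `X` of edges, the number of spanning trees containing `X` is at most
`(2/n)^|X| · n^(n-2)`. -/
theorem spanning_trees_spread (n : ℕ) (X : Finset (Sym2 (Fin n))) :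
    (Nat.card {T : SimpleGraph (Fin n) // T.IsTree ∧ (X : Set (Sym2 (Fin n))) ⊆ T.edgeSet} : ℝ)
      ≤ (2 / n) ^ X.card * (n : ℝ) ^ (n - 2) := by
  have htrees := SimpleGraph.card_trees_mul_card_le X
  have hmaps := card_parentMapsContaining_mul_le X
  rw [Fintype.card_fin] at htrees hmaps
  set t := Nat.card {T : SimpleGraph (Fin n) // T.IsTree ∧ (X : Set (Sym2 (Fin n))) ⊆ T.edgeSet}
    with ht
  rcases Nat.eq_zero_or_pos n with rfl | hn
  · have : IsEmpty {T : SimpleGraph (Fin 0) // T.IsTree ∧ (X : Set (Sym2 (Fin 0))) ⊆ T.edgeSet} :=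
      ⟨fun T => T.2.1.connected.nonempty.elim finZeroElim⟩
    rw [ht, Nat.card_of_isEmpty, Nat.cast_zero]
    positivity
  have hpow : n ^ n ≤ n ^ (n - 2) * n ^ 2 := by
    rw [← pow_add]
    exact Nat.pow_le_pow_right hn (by omega)
  have hbound : t * n ^ #X * n ^ 2 ≤ 2 ^ #X * n ^ (n - 2) * n ^ 2 :=
    calc t * n ^ #X * n ^ 2 = t * n * n ^ (#X + 1) := by ring
      _ ≤ 2 ^ #X * n ^ n := (Nat.mul_le_mul_right _ htrees).trans hmaps
      _ ≤ 2 ^ #X * (n ^ (n - 2) * n ^ 2) := by gcongr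
      _ = _ := by ring
  have hbound' : (t : ℝ) * n ^ #X ≤ 2 ^ #X * n ^ (n - 2) := by
    exact_mod_cast Nat.le_of_mul_le_mul_right hbound (by positivity)
  rw [div_pow, div_mul_eq_mul_div, le_div_iff₀ (by positivity)]
  exact hbound'
end

section
/- If a forest F on n vertices with at most n-1 edges is not 6-star-like (no edge of F is incident to at least (n-1)/6 other edges of F) and n ≥ 5, then at least e^(-4)·n^(n-2) spanning trees of K_n are edge-disjoint from F. -/
open Finset Matrix

section ParentFunctions

variable {V : Type*}

/-- The graph that joins every vertex `v ≠ r` to its parent `p v`. -/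
def parentGraph (r : V) (p : V → V) : SimpleGraph V :=
  SimpleGraph.fromRel fun v u => v ≠ r ∧ p v = u

lemma parentGraph_adj {r : V} {p : V → V} {v u : V} :
    (parentGraph r p).Adj v u ↔ v ≠ u ∧ ((v ≠ r ∧ p v = u) ∨ (u ≠ r ∧ p u = v)) :=
  SimpleGraph.fromRel_adj _ _ _

lemma parentGraph_connected {r : V} {p : V → V} (hp : ∀ v, ∃ k, p^[k] v = r) :
    (parentGraph r p).Connected := by
  have key : ∀ k v, p^[k] v = r → (parentGraph r p).Reachable v r := by
    intro k
    induction k with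
    | zero => intro v hv; exact hv ▸ SimpleGraph.Reachable.refl _
    | succ k ih =>
      intro v hv
      by_cases hvr : v = r
      · exact hvr ▸ SimpleGraph.Reachable.refl _
      have h := ih (p v) hv
      by_cases hvp : v = p v
      · rwa [← hvp] at h
      · exact (SimpleGraph.Adj.reachable (parentGraph_adj.2 ⟨hvp, .inl ⟨hvr, rfl⟩⟩)).trans h
  have reach : ∀ v, (parentGraph r p).Reachable v r := fun v => (hp v).elim fun k hk => key k v hk
  exact SimpleGraph.connected_iff _ |>.2 ⟨fun v w => (reach v).trans (reach w).symm, ⟨r⟩⟩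

lemma parentGraph_isTree [Finite V] {r : V} {p : V → V} (hp : ∀ v, ∃ k, p^[k] v = r) :
    (parentGraph r p).IsTree := by
  have hconn := parentGraph_connected hp
  refine SimpleGraph.isTree_iff_connected_and_card.2
    ⟨hconn, le_antisymm ?_ hconn.card_vert_le_card_edgeSet_add_one⟩
  have hsub : (parentGraph r p).edgeSet ⊆ (fun v => s(v, p v)) '' ({r}ᶜ : Set V) := by
    intro e
    induction e with | _ v u
    rw [SimpleGraph.mem_edgeSet, parentGraph_adj]
    rintro ⟨-, ⟨hv, rfl⟩ | ⟨hu, rfl⟩⟩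
    · exact ⟨v, hv, rfl⟩
    · exact ⟨u, hu, Sym2.eq_swap⟩
  have h := (Set.ncard_le_ncard hsub).trans (Set.ncard_image_le)
  have hr := Set.ncard_add_ncard_compl ({r} : Set V)
  rw [Set.ncard_singleton] at hr
  rw [Nat.card_coe_set_eq]
  omega

/-- A function all of whose orbits reach `r` is determined, away from `r`, by its graph. -/
lemma parentGraph_injective {r : V} {p q : V → V} (hpr : p r = r) (hqr : q r = r)
    (hp : ∀ v, ∃ k, p^[k] v = r) (hpv : ∀ v, v ≠ r → v ≠ p v)
    (h : parentGraph r p = parentGraph r q) : p = q := by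
  by_contra hne
  obtain ⟨v, hv⟩ := Function.ne_iff.1 hne
  have step : ∀ v, p v ≠ q v → p (p v) ≠ q (p v) := by
    intro v hv
    have hvr : v ≠ r := by rintro rfl; exact hv (hpr.trans hqr.symm)
    have hadj : (parentGraph r p).Adj v (p v) := parentGraph_adj.2 ⟨hpv v hvr, .inl ⟨hvr, rfl⟩⟩
    rw [h, parentGraph_adj] at hadj
    obtain ⟨-, ⟨-, h1⟩ | ⟨h1, h2⟩⟩ := hadj
    · exact absurd h1.symm hv
    · rw [h2]
      intro h3
      have orbit : ∀ k, p^[k] v = v ∨ p^[k] v = p v := by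
        intro k
        induction k with
        | zero => exact .inl rfl
        | succ k ih =>
          rw [Function.iterate_succ_apply']
          rcases ih with ih | ih <;> rw [ih]
          · exact .inr rfl
          · exact .inl h3
      obtain ⟨k, hk⟩ := hp v
      rcases orbit k with ho | ho
      · exact hvr (ho.symm.trans hk)
      · exact h1 (ho.symm.trans hk)
  have all : ∀ k, p (p^[k] v) ≠ q (p^[k] v) := by
    intro k
    induction k with
    | zero => exact hv
    | succ k ih => rw [Function.iterate_succ_apply']; exact step _ ih
  obtain ⟨k, hk⟩ := hp v
  exact all k (by rw [hk, hpr, hqr])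

variable [DecidableEq V]

/-- The 0-1 matrix of the function `p` with the row of the root `r` erased. -/
def parentMatrix (r : V) (p : V → V) : Matrix V V ℝ :=
  of fun v u => if v = r then 0 else if u = p v then 1 else 0

variable [Fintype V]

lemma parentMatrix_mulVec (r : V) (p : V → V) (x : V → ℝ) (v : V) :
    (parentMatrix r p *ᵥ x) v = if v = r then 0 else x (p v) := by
  by_cases hv : v = r <;> simp [parentMatrix, mulVec, dotProduct, hv]

lemma isNilpotent_parentMatrix {r : V} {p : V → V} (hp : ∀ v, ∃ k, p^[k] v = r) :
    IsNilpotent (parentMatrix r p) := by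
  choose k hk using hp
  have key : ∀ m x v, (∃ j < m, p^[j] v = r) → ((parentMatrix r p ^ m) *ᵥ x) v = 0 := by
    intro m
    induction m with
    | zero => simp
    | succ m ih =>
      rintro x v ⟨j, hj, hjr⟩
      rw [pow_succ', ← mulVec_mulVec, parentMatrix_mulVec]
      split_ifs with hv
      · rfl
      · cases j with
        | zero => exact absurd hjr hv
        | succ j => exact ih x _ ⟨j, by omega, hjr⟩
  refine ⟨univ.sup k + 1, ext_of_mulVec_single fun i => funext fun v => ?_⟩
  rw [key _ _ v ⟨k v, Nat.lt_succ_of_le (le_sup (mem_univ v)), hk v⟩]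
  simp

lemma det_one_sub_of_isNilpotent {N : Matrix V V ℝ} (hN : IsNilpotent N) : (1 - N).det = 1 := by
  have h := (isNilpotent_charpoly_sub_pow_of_isNilpotent hN).eq_zero
  have h' := eval_charpoly N 1
  rw [sub_eq_zero.1 h] at h'
  simpa using h'.symm

lemma det_one_sub_parentMatrix_of_not_forall {r : V} {p : V → V}
    (hp : ¬ ∀ v, ∃ k, p^[k] v = r) : (1 - parentMatrix r p).det = 0 := by
  classical
  push Not at hp
  obtain ⟨w, hw⟩ := hp
  rw [← exists_mulVec_eq_zero_iff]
  refine ⟨fun v => if ∃ k, p^[k] v = r then 0 else 1, fun h => ?_, funext fun v => ?_⟩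
  · simpa [hw] using congrFun h w
  · rw [sub_mulVec, one_mulVec, Pi.sub_apply, parentMatrix_mulVec]
    by_cases hv : v = r
    · simpa [hv] using ⟨0, rfl⟩
    · have : (∃ k, p^[k] v = r) ↔ ∃ k, p^[k] (p v) = r := by
        constructor
        · rintro ⟨k, hk⟩
          cases k with
          | zero => exact absurd hk hv
          | succ k => exact ⟨k, hk⟩
        · rintro ⟨k, hk⟩
          exact ⟨k + 1, hk⟩
      simp [hv, this]

end ParentFunctions

section Laplacian

variable {V : Type*} [DecidableEq V] [Fintype V]

/-- The reduced Laplacian determinant counts parent functions along the edges of `H` all of whose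
orbits reach the root, so it is at most the number of spanning trees of `H`. -/
lemma det_updateRow_lapMatrix_le (H : SimpleGraph V) [DecidableRel H.Adj] (r : V) :
    ((H.lapMatrix ℝ).updateRow r (Pi.single r 1)).det ≤
      (Nat.card {T : SimpleGraph V // T.IsTree ∧ T ≤ H} : ℝ) := by
  classical
  let A : V → Finset V := fun v => if v = r then {r} else H.neighborFinset v
  let g : V → V → V → ℝ := fun v u =>
    if v = r then Pi.single r 1 else Pi.single v 1 - Pi.single u 1
  have hrow : (H.lapMatrix ℝ).updateRow r (Pi.single r 1) = fun v => ∑ u ∈ A v, g v u := by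
    funext v
    by_cases hv : v = r
    · subst hv; simp [A, g]
    · ext w
      simp only [updateRow_ne hv, A, g, hv, if_false, Finset.sum_apply, Pi.sub_apply,
        Pi.single_apply, Finset.sum_sub_distrib, SimpleGraph.lapMatrix, SimpleGraph.degMatrix,
        Matrix.sub_apply, diagonal_apply, SimpleGraph.adjMatrix_apply]
      by_cases hvw : v = w <;> simp [hvw, eq_comm]
  have hexp : ((H.lapMatrix ℝ).updateRow r (Pi.single r 1)).det =
      ∑ p ∈ Fintype.piFinset A, (1 - parentMatrix r p).det := by
    rw [hrow]
    refine ((detRowAlternating (n := V) (R := ℝ)).toMultilinearMap.map_sum_finset g A).trans ?_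
    refine Finset.sum_congr rfl fun p _ => congrArg det ?_
    ext v w
    by_cases hv : v = r
    · simp [g, hv, parentMatrix, Matrix.one_apply, Pi.single_apply, eq_comm]
    · simp [g, hv, parentMatrix, Matrix.one_apply, Pi.single_apply, eq_comm (a := w)]
  let P := {p ∈ Fintype.piFinset A | ∀ v, ∃ k, p^[k] v = r}
  have hmem : ∀ p ∈ P, p r = r ∧ (∀ v, v ≠ r → H.Adj v (p v)) ∧ ∀ v, ∃ k, p^[k] v = r := by
    intro p hp
    obtain ⟨h1, h2⟩ := Finset.mem_filter.1 hp
    rw [Fintype.mem_piFinset] at h1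
    refine ⟨by simpa [A] using h1 r, fun v hv => by simpa [A, hv] using h1 v, h2⟩
  have hdet : ((H.lapMatrix ℝ).updateRow r (Pi.single r 1)).det = (#P : ℝ) := by
    rw [hexp, Finset.card_filter, Nat.cast_sum]
    refine Finset.sum_congr rfl fun p _ => ?_
    split_ifs with hp
    · rw [det_one_sub_of_isNilpotent (isNilpotent_parentMatrix hp), Nat.cast_one]
    · rw [det_one_sub_parentMatrix_of_not_forall hp, Nat.cast_zero]
  rw [hdet, Nat.cast_le, ← Nat.card_eq_finsetCard]
  let toTree : P → {T : SimpleGraph V // T.IsTree ∧ T ≤ H} := fun p =>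
    ⟨parentGraph r p, parentGraph_isTree (hmem p p.2).2.2, by
      intro v u huv
      obtain ⟨-, ⟨hv, rfl⟩ | ⟨hu, rfl⟩⟩ := parentGraph_adj.1 huv
      · exact (hmem p p.2).2.1 v hv
      · exact ((hmem p p.2).2.1 u hu).symm⟩
  refine Nat.card_le_card_of_injective toTree fun p q hpq => Subtype.ext ?_
  obtain ⟨hpr, hpa, hp⟩ := hmem p p.2
  exact parentGraph_injective hpr (hmem q q.2).1 hp (fun v hv => (hpa v hv).ne)
    (congrArg Subtype.val hpq)

lemma det_one_add_vecMulVec (u v : V → ℝ) : (1 + vecMulVec u v).det = 1 + v ⬝ᵥ u := by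
  rw [vecMulVec_eq Unit, det_one_add_replicateCol_mul_replicateRow]

/-- The determinant of `L + J`, where the rows and columns of `L` sum to zero and `J` is the
all-ones matrix. -/
lemma det_add_vecMulVec_one (L : Matrix V V ℝ) (hrow : L *ᵥ 1 = 0) (hcol : 1 ᵥ* L = 0) (r : V) :
    (L + vecMulVec 1 1).det =
      (Fintype.card V : ℝ) ^ 2 * (L.updateRow r (Pi.single r 1)).det := by
  let e : V → ℝ := Pi.single r 1
  have h1 : (1 + vecMulVec (-e) (1 - e)) * L.updateRow r e = L + vecMulVec e e := by
    have hC : L.updateRow r e = L + vecMulVec e (e - L r) := by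
      ext v w
      by_cases hv : v = r
      · subst hv; simp [e, vecMulVec_apply]
      · simp [e, vecMulVec_apply, hv]
    have heL : e ᵥ* L = L r := by simp [e, Matrix.row]
    rw [hC, add_mul, one_mul, vecMulVec_mul, vecMul_add, sub_vecMul, hcol, heL]
    have h0 : (1 - e) ᵥ* vecMulVec e (e - L r) = 0 := by
      rw [vecMul_vecMulVec]
      simp [e]
    rw [h0]
    ext v w
    simp [vecMulVec_apply]
    ring
  have h2 : (1 + vecMulVec (1 - e) 1) * (L + vecMulVec e e) = L + vecMulVec 1 e := by
    rw [add_mul, one_mul, vecMulVec_mul, vecMul_add, hcol, vecMul_vecMulVec]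
    ext v w
    simp [vecMulVec_apply, e]
    ring
  have h3 : (L + vecMulVec 1 e) * (1 + vecMulVec 1 (1 - e)) = L + vecMulVec 1 1 := by
    rw [mul_add, mul_one, mul_vecMulVec, add_mulVec, hrow, vecMulVec_mulVec]
    ext v w
    simp [e]
  rw [← h3, ← h2, ← h1, det_mul, det_mul, det_mul, det_one_add_vecMulVec, det_one_add_vecMulVec,
    det_one_add_vecMulVec]
  have d1 : 1 + (1 - e) ⬝ᵥ (-e) = 1 := by simp [e]
  have d2 : 1 + (1 : V → ℝ) ⬝ᵥ (1 - e) = Fintype.card V := by simp [e]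
  have d3 : 1 + (1 - e) ⬝ᵥ (1 : V → ℝ) = Fintype.card V := by simp [e]
  rw [d1, d2, d3]
  ring

lemma lapMatrix_compl_add_one (F : SimpleGraph V) [DecidableRel F.Adj] :
    Fᶜ.lapMatrix ℝ + vecMulVec 1 1 = (Fintype.card V : ℝ) • 1 - F.lapMatrix ℝ := by
  ext v w
  have hdeg := F.degree_compl v
  have hlt := F.degree_lt_card_verts v
  by_cases hvw : v = w
  · subst hvw
    have : (Fᶜ.degree v : ℝ) + 1 + F.degree v = Fintype.card V := by
      norm_cast; omega
    simp [SimpleGraph.lapMatrix, SimpleGraph.degMatrix]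
    linarith
  · by_cases ha : F.Adj v w <;>
      simp [SimpleGraph.lapMatrix, SimpleGraph.degMatrix, hvw, ha]

end Laplacian

lemma exp_neg_two_mul_le {x : ℝ} (h0 : 0 ≤ x) (h1 : x ≤ 1 / 2) : Real.exp (-2 * x) ≤ 1 - x := by
  have h := Real.add_one_le_exp (2 * x)
  have hm : Real.exp (-2 * x) * Real.exp (2 * x) = 1 := by
    rw [← Real.exp_add]; simp
  nlinarith [Real.exp_pos (-2 * x), Real.exp_pos (2 * x)]

section Spectrum

variable {V : Type*} [DecidableEq V] [Fintype V]

lemma exp_mul_pow_le_det {A : Matrix V V ℝ} (hA : A.IsHermitian) {c : ℝ} (hc : 0 < c)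
    (h : ∀ i, c / 2 ≤ hA.eigenvalues i ∧ hA.eigenvalues i ≤ c) :
    Real.exp (-2 * (Fintype.card V - A.trace / c)) * c ^ Fintype.card V ≤ A.det := by
  have key : ∀ i, Real.exp (-2 * (1 - hA.eigenvalues i / c)) * c ≤ hA.eigenvalues i := by
    intro i
    obtain ⟨h1, h2⟩ := h i
    have h3 : hA.eigenvalues i / c ≤ 1 := (div_le_one hc).2 h2
    have h4 : 1 / 2 ≤ hA.eigenvalues i / c := by rw [le_div_iff₀ hc]; linarith
    have h5 := exp_neg_two_mul_le (x := 1 - hA.eigenvalues i / c) (by linarith) (by linarith)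
    calc _ ≤ (1 - (1 - hA.eigenvalues i / c)) * c := by gcongr
      _ = hA.eigenvalues i := by field_simp; ring
  rw [hA.det_eq_prod_eigenvalues]
  calc _ = ∏ i, (Real.exp (-2 * (1 - hA.eigenvalues i / c)) * c) := by
        rw [Finset.prod_mul_distrib, ← Real.exp_sum, ← Finset.mul_sum, Finset.sum_sub_distrib,
          ← Finset.sum_div, hA.trace_eq_sum_eigenvalues]
        simp
    _ ≤ _ := Finset.prod_le_prod (fun i _ => by positivity) fun i _ => by simpa using key i

/-- Gershgorin bounds for `c - L` with `L` the Laplacian of `F`. -/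
lemma eigenvalues_smul_one_sub_lapMatrix (F : SimpleGraph V) [DecidableRel F.Adj] {c : ℝ}
    (hA : (c • (1 : Matrix V V ℝ) - F.lapMatrix ℝ).IsHermitian)
    (hdeg : ∀ v, 4 * (F.degree v : ℝ) ≤ c) (i : V) :
    c / 2 ≤ hA.eigenvalues i ∧ hA.eigenvalues i ≤ c := by
  have hspec := hA.eigenvalues_mem_spectrum_real i
  rw [← spectrum_toLin', ← Module.End.hasEigenvalue_iff_mem_spectrum] at hspec
  obtain ⟨k, hk⟩ := eigenvalue_mem_ball hspec
  have hsum : ∑ j ∈ univ.erase k, ‖(c • (1 : Matrix V V ℝ) - F.lapMatrix ℝ) k j‖ = F.degree k := by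
    rw [F.degree_eq_sum_if_adj (R := ℝ), ← Finset.sum_erase univ (a := k) (by simp)]
    refine Finset.sum_congr rfl fun j hj => ?_
    have hkj : k ≠ j := (Finset.ne_of_mem_erase hj).symm
    by_cases ha : F.Adj k j <;> simp [SimpleGraph.lapMatrix, SimpleGraph.degMatrix, hkj, ha]
  have hdiag : (c • (1 : Matrix V V ℝ) - F.lapMatrix ℝ) k k = c - F.degree k := by
    simp [SimpleGraph.lapMatrix, SimpleGraph.degMatrix]
  rw [hsum, hdiag, Metric.mem_closedBall, Real.dist_eq, abs_le] at hk
  have := hdeg k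
  constructor <;> linarith [hk.1, hk.2]

lemma trace_smul_one_sub_lapMatrix (F : SimpleGraph V) [DecidableRel F.Adj] (c : ℝ) :
    (c • (1 : Matrix V V ℝ) - F.lapMatrix ℝ).trace = c * Fintype.card V - 2 * #F.edgeFinset := by
  have h := F.sum_degrees_eq_twice_card_edges
  have h' : ∑ v, (F.degree v : ℝ) = 2 * #F.edgeFinset := by exact_mod_cast h
  rw [← h']
  simp [SimpleGraph.lapMatrix, SimpleGraph.degMatrix, trace_sub]

end Spectrum

/-- An edge at `v` meets the `degree v - 1` other edges at `v`. -/
lemma exists_edge_degree_le_ncard_add_one {V : Type*} [Fintype V] [DecidableEq V]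
    (F : SimpleGraph V) [DecidableRel F.Adj] {v : V} (hv : F.degree v ≠ 0) :
    ∃ e ∈ F.edgeSet,
      F.degree v ≤ {e' ∈ F.edgeSet | e' ≠ e ∧ ∃ w, w ∈ e ∧ w ∈ e'}.ncard + 1 := by
  obtain ⟨u, hu⟩ := (F.degree_pos_iff_exists_adj v).1 (Nat.pos_of_ne_zero hv)
  refine ⟨s(v, u), hu, ?_⟩
  rw [← F.card_incidenceFinset_eq_degree v]
  have hmem : s(v, u) ∈ F.incidenceFinset v := by simpa using hu
  rw [← Finset.card_erase_add_one hmem, ← Set.ncard_coe_finset]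
  refine Nat.add_le_add_right (Set.ncard_le_ncard ?_) 1
  intro e he
  simp only [coe_erase, Set.mem_sdiff, Finset.mem_coe, SimpleGraph.mem_incidenceFinset,
    Set.mem_singleton_iff] at he
  exact ⟨he.1.1, he.2, v, Sym2.mem_mk_left v u, he.1.2⟩

/-- If a forest `F` on `n ≥ 5` vertices with at most `n - 1` edges is not `6`-star-like
(no edge of `F` is incident to at least `(n-1)/6` other edges of `F`), then at least
`e^(-4) · n^(n-2)` spanning trees of `K_n` are edge-disjoint from `F`. -/
theorem trees_avoiding_non_starlike_forest (n : ℕ) (hn : 5 ≤ n)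
    (F : SimpleGraph (Fin n)) (hF : F.IsAcyclic)
    (hedges : F.edgeSet.ncard ≤ n - 1)
    (hnotstar : ∀ e ∈ F.edgeSet,
      ({e' ∈ F.edgeSet | e' ≠ e ∧ ∃ v, v ∈ e ∧ v ∈ e'}.ncard : ℝ) < ((n : ℝ) - 1) / 6) :
    Real.exp (-4) * (n : ℝ) ^ (n - 2) ≤
      (Nat.card {T : SimpleGraph (Fin n) // T.IsTree ∧ Disjoint T.edgeSet F.edgeSet} : ℝ) := by
  classical
  have hn' : (5 : ℝ) ≤ n := by exact_mod_cast hn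
  have hn0 : (0 : ℝ) < n := by linarith
  have hdeg : ∀ v, 4 * (F.degree v : ℝ) ≤ n := by
    intro v
    by_cases hv : F.degree v = 0
    · simp [hv]
    obtain ⟨e, he, hle⟩ := exists_edge_degree_le_ncard_add_one F hv
    have hlt := hnotstar e he
    set k := {e' ∈ F.edgeSet | e' ≠ e ∧ ∃ w, w ∈ e ∧ w ∈ e'}.ncard
    have hk : 6 * k + 1 < n := by
      have : (6 * k + 1 : ℝ) < n := by linarith
      exact_mod_cast this
    exact_mod_cast (by omega : 4 * F.degree v ≤ n)
  have hE : (#F.edgeFinset : ℝ) ≤ n := by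
    rw [← F.coe_edgeFinset, Set.ncard_coe_finset] at hedges
    exact_mod_cast hedges.trans (Nat.sub_le n 1)
  have hA : ((n : ℝ) • (1 : Matrix (Fin n) (Fin n) ℝ) - F.lapMatrix ℝ).IsHermitian :=
    (isHermitian_one.smul (IsSelfAdjoint.all _)).sub (F.isHermitian_lapMatrix ℝ)
  have hdet := exp_mul_pow_le_det hA hn0 (eigenvalues_smul_one_sub_lapMatrix F hA hdeg)
  rw [trace_smul_one_sub_lapMatrix, Fintype.card_fin] at hdet
  have hexp : Real.exp (-4) ≤ Real.exp (-2 * (n - (n * n - 2 * #F.edgeFinset) / n)) := by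
    rw [Real.exp_le_exp]
    have : (n : ℝ) - (n * n - 2 * #F.edgeFinset) / n = 2 * (#F.edgeFinset / n) := by
      field_simp
      ring
    have := (div_le_one hn0).2 hE
    linarith
  let r : Fin n := ⟨0, by omega⟩
  have hrow : Fᶜ.lapMatrix ℝ *ᵥ 1 = 0 := Fᶜ.lapMatrix_mulVec_const_eq_zero
  have hcol : 1 ᵥ* Fᶜ.lapMatrix ℝ = 0 := by
    rw [← mulVec_transpose, (Fᶜ.isSymm_lapMatrix ℝ).eq, hrow]
  have hL := det_add_vecMulVec_one (Fᶜ.lapMatrix ℝ) hrow hcol r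
  rw [lapMatrix_compl_add_one, Fintype.card_fin] at hL
  have htrees : ∀ T : SimpleGraph (Fin n),
      (T.IsTree ∧ Disjoint T.edgeSet F.edgeSet) ↔ (T.IsTree ∧ T ≤ Fᶜ) := fun T => by
    rw [SimpleGraph.disjoint_edgeSet, le_compl_iff_disjoint_right]
  rw [Nat.card_congr (Equiv.subtypeEquivRight htrees)]
  refine le_trans ?_ (det_updateRow_lapMatrix_le Fᶜ r)
  refine le_of_mul_le_mul_left ?_ (pow_pos hn0 2)
  calc (n : ℝ) ^ 2 * (Real.exp (-4) * n ^ (n - 2))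
      = Real.exp (-4) * n ^ n := by
        rw [mul_left_comm, ← pow_add, Nat.add_sub_cancel' (by omega)]
    _ ≤ Real.exp (-2 * (n - (n * n - 2 * #F.edgeFinset) / n)) * n ^ n := by gcongr
    _ ≤ _ := hdet.trans hL.le
end

section
/- Let n ≥ 8 and let t be even with 3(t+2)/2 ≤ n. Let F be a forest in K_n consisting of t/2 + 1 vertex-disjoint paths on 3 vertices (so F has t+2 edges). Then the number of spanning trees of K_n containing at least t+1 edges of F equals 3^(t/2) · n^(n-t-4) · (2nt + 4n - 3t - 3). -/
open Finset

namespace SimpleGraph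

section Cayley

variable {V ι : Type*}

/-- `f` labels the vertices of `G` so that two vertices get the same label exactly when they lie
in the same connected component. -/
def LabelsComponents (G : SimpleGraph V) (f : V → ι) : Prop :=
  ∀ u v, G.Reachable u v ↔ f u = f v

lemma labelsComponents_of_rep {G : SimpleGraph V} {f : V → V}
    (hadj : ∀ a b, G.Adj a b → f a = f b) (hrep : ∀ w, G.Reachable w (f w)) :
    G.LabelsComponents f := by
  refine fun u v ↦ ⟨?_, fun h ↦ (hrep u).trans (h ▸ (hrep v).symm)⟩
  rintro ⟨p⟩
  induction p with
  | nil => rfl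
  | cons h _ ih => exact (hadj _ _ h).trans ih

variable [DecidableEq ι]

/-- The labelling obtained from `f` by giving all vertices labelled `b` the label `a`. -/
def mergeLabel (f : V → ι) (a b : ι) (w : V) : ι := if f w = b then a else f w

lemma LabelsComponents.sup_edge {G : SimpleGraph V} {f : V → ι} (hf : G.LabelsComponents f)
    {u v : V} (huv : f u ≠ f v) :
    (G ⊔ edge u v).LabelsComponents (mergeLabel f (f u) (f v)) := by
  have hne : u ≠ v := fun h ↦ huv (congrArg f h)
  have hle {a b : V} (h : f a = f b) : (G ⊔ edge u v).Reachable a b :=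
    ((hf a b).2 h).mono le_sup_left
  have huv' : (G ⊔ edge u v).Reachable u v :=
    Adj.reachable (by simp [edge_adj, hne])
  intro a b
  constructor
  · rintro ⟨p⟩
    induction p with
    | nil => rfl
    | cons h _ ih =>
      refine Eq.trans ?_ ih
      rcases h with h | h
      · simp [mergeLabel, (hf _ _).1 h.reachable]
      · rw [edge_adj] at h
        rcases h.1 with ⟨rfl, rfl⟩ | ⟨rfl, rfl⟩ <;> simp [mergeLabel]
  · unfold mergeLabel
    split_ifs with h₁ h₂ h₂ <;> intro h
    · exact hle (h₁.trans h₂.symm)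
    · exact (hle h₁).trans (huv'.symm.trans (hle h))
    · exact (hle h).trans (huv'.trans (hle h₂.symm))
    · exact hle h

variable [Fintype V]

/-- The number of vertices with label `i`. -/
def labelCard (f : V → ι) (i : ι) : ℕ := #{w | f w = i}

/-- The product over all label classes of `|V|` times the size of the class. -/
def labelWeight (f : V → ι) : ℕ := ∏ i ∈ univ.image f, Fintype.card V * labelCard f i

/-- The number of trees on `V` containing `G`. -/
noncomputable def treeCount (G : SimpleGraph V) : ℕ :=
  open Classical in #{T : SimpleGraph V | T.IsTree ∧ G ≤ T}

lemma image_mergeLabel {f : V → ι} {u v : V} (huv : f u ≠ f v) :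
    univ.image (mergeLabel f (f u) (f v)) = (univ.image f).erase (f v) := by
  ext i
  simp only [mem_image, mem_univ, true_and, mem_erase, mergeLabel]
  grind

lemma labelCard_mergeLabel_left {f : V → ι} {a b : ι} (hab : a ≠ b) :
    labelCard (mergeLabel f a b) a = labelCard f a + labelCard f b := by
  classical
  unfold labelCard
  rw [← card_union_of_disjoint (disjoint_filter.2 (by grind)), ← filter_or]
  congr 1; ext w; simp only [mergeLabel, mem_filter]; grind

lemma labelCard_mergeLabel_of_ne {f : V → ι} {a b i : ι} (ha : i ≠ a) (hb : i ≠ b) :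
    labelCard (mergeLabel f a b) i = labelCard f i := by
  unfold labelCard
  congr 1; ext w; simp only [mergeLabel, mem_filter]; grind

lemma labelWeight_mergeLabel {f : V → ι} {u v : V} (huv : f u ≠ f v) :
    labelWeight (mergeLabel f (f u) (f v)) *
        (Fintype.card V * labelCard f (f u) * labelCard f (f v)) =
      labelWeight f * (labelCard f (f u) + labelCard f (f v)) := by
  have hv : f v ∈ univ.image f := mem_image_of_mem f (mem_univ v)
  have hu : f u ∈ (univ.image f).erase (f v) := mem_erase.2 ⟨huv, mem_image_of_mem f (mem_univ u)⟩
  unfold labelWeight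
  rw [image_mergeLabel huv, ← mul_prod_erase _ _ hv, ← mul_prod_erase _ _ hu,
    ← mul_prod_erase _ _ hu, labelCard_mergeLabel_left huv,
    prod_congr rfl fun i hi ↦ by
      rw [labelCard_mergeLabel_of_ne (ne_of_mem_erase hi)
        (ne_of_mem_erase (mem_of_mem_erase hi))]]
  ring

lemma labelCard_pos (f : V → ι) (u : V) : 0 < labelCard f (f u) :=
  card_pos.2 ⟨u, by simp⟩

lemma sum_inv_labelCard (f : V → ι) :
    ∑ u, (labelCard f (f u) : ℚ)⁻¹ = #(univ.image f) := by
  rw [sum_comp (fun i ↦ (labelCard f i : ℚ)⁻¹) f, card_eq_sum_ones, Nat.cast_sum]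
  refine sum_congr rfl fun i hi ↦ ?_
  obtain ⟨u, -, rfl⟩ := mem_image.1 hi
  have := (labelCard_pos f u).ne'
  rw [nsmul_eq_mul, Nat.cast_one]
  exact mul_inv_cancel₀ (by exact_mod_cast this)

lemma sum_labelWeight_mergeLabel [Nonempty V] (f : V → ι) :
    ∑ p : V × V with f p.1 ≠ f p.2, (labelWeight (mergeLabel f (f p.1) (f p.2)) : ℚ) =
      2 * (#(univ.image f) - 1) * labelWeight f := by
  have hn : (Fintype.card V : ℚ) ≠ 0 := by simp
  set n : ℚ := (Fintype.card V : ℚ)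
  have hpos (u : V) : (labelCard f (f u) : ℚ) ≠ 0 := by exact_mod_cast (labelCard_pos f u).ne'
  have hterm (p : V × V) (hp : f p.1 ≠ f p.2) :
      (labelWeight (mergeLabel f (f p.1) (f p.2)) : ℚ) =
        labelWeight f / n *
          ((labelCard f (f p.1) : ℚ)⁻¹ + (labelCard f (f p.2) : ℚ)⁻¹) := by
    have h : ((labelWeight (mergeLabel f (f p.1) (f p.2)) *
        (Fintype.card V * labelCard f (f p.1) * labelCard f (f p.2)) : ℕ) : ℚ) = _ :=
      congrArg _ (labelWeight_mergeLabel hp)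
    push_cast at h
    have h1 := hpos p.1
    have h2 := hpos p.2
    field_simp
    linear_combination h
  have hrow (u : V) : ∑ v with f u ≠ f v, (labelCard f (f u) : ℚ)⁻¹ =
      n * (labelCard f (f u) : ℚ)⁻¹ - 1 := by
    have hc : (#{v | f u ≠ f v} : ℚ) + labelCard f (f u) = n := by
      have := card_filter_add_card_filter_not (s := (univ : Finset V)) (fun v ↦ f v = f u)
      rw [card_univ] at this
      rw [add_comm]
      unfold labelCard
      simp only [eq_comm (a := f u), ne_eq, n]
      exact_mod_cast this
    have h1 := hpos u
    rw [sum_const, nsmul_eq_mul]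
    field_simp
    linear_combination hc
  have hhalf : ∑ p : V × V with f p.1 ≠ f p.2, (labelCard f (f p.1) : ℚ)⁻¹ =
      n * #(univ.image f) - n := by
    rw [sum_filter, Fintype.sum_prod_type]
    simp_rw [← sum_filter, hrow]
    rw [sum_sub_distrib, ← mul_sum, sum_inv_labelCard]
    simp [n]
  have hhalf' : ∑ p : V × V with f p.1 ≠ f p.2, (labelCard f (f p.2) : ℚ)⁻¹ =
      n * #(univ.image f) - n := by
    rw [← hhalf]
    refine sum_equiv (Equiv.prodComm V V) ?_ ?_ <;> simp [eq_comm]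
  rw [sum_congr rfl fun p hp ↦ hterm p (mem_filter.1 hp).2, ← mul_sum, sum_add_distrib, hhalf,
    hhalf']
  field_simp
  ring

lemma two_mul_ncard_edgeSet (G : SimpleGraph V) [DecidableRel G.Adj] :
    2 * G.edgeSet.ncard = #{p : V × V | G.Adj p.1 p.2} := by
  rw [← coe_edgeFinset, Set.ncard_coe_finset]
  exact G.two_mul_card_edgeFinset

lemma IsTree.ncard_edgeSet_add_one {T : SimpleGraph V} (hT : T.IsTree) :
    T.edgeSet.ncard + 1 = Fintype.card V := by
  simpa [Nat.card_eq_fintype_card] using (isTree_iff_connected_and_card.1 hT).2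

open Classical in
/-- A tree containing `G` has exactly `#labels - 1` edges between different components of `G`. -/
lemma IsTree.card_adj_labels_ne {G T : SimpleGraph V} {f : V → ι} (hf : G.LabelsComponents f)
    (hG : G.edgeSet.ncard + #(univ.image f) = Fintype.card V) (hT : T.IsTree) (hGT : G ≤ T) :
    #{p : V × V | f p.1 ≠ f p.2 ∧ T.Adj p.1 p.2} + 2 = 2 * #(univ.image f) := by
  have hset : ({p : V × V | f p.1 ≠ f p.2 ∧ T.Adj p.1 p.2} : Finset (V × V)) =
      ({p : V × V | (T \ G).Adj p.1 p.2} : Finset (V × V)) := by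
    ext ⟨u, v⟩
    simp only [mem_filter, mem_univ, true_and, sdiff_adj]
    refine ⟨fun h ↦ ⟨h.2, fun h' ↦ h.1 ((hf _ _).1 h'.reachable)⟩, fun h ↦ ⟨fun h' ↦ ?_, h.1⟩⟩
    have hb := isAcyclic_iff_forall_isBridge.1 hT.isAcyclic ((mem_edgeSet T).2 h.1)
    refine isBridge_iff.1 hb (((hf u v).2 h').mono fun a b hab ↦ ?_)
    rw [deleteEdges_adj]
    refine ⟨hGT hab, fun hmem ↦ h.2 ?_⟩
    rw [Set.mem_singleton_iff] at hmem
    exact (mem_edgeSet G).1 (hmem ▸ (mem_edgeSet G).2 hab)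
  rw [hset, ← two_mul_ncard_edgeSet, edgeSet_sdiff]
  have h1 := Set.ncard_sdiff_add_ncard_of_subset (edgeSet_mono hGT) (Set.toFinite _)
  have h2 := hT.ncard_edgeSet_add_one
  omega

open Classical in
lemma sum_treeCount_sup_edge {G : SimpleGraph V} {f : V → ι} (hf : G.LabelsComponents f)
    (hG : G.edgeSet.ncard + #(univ.image f) = Fintype.card V) :
    ∑ p : V × V with f p.1 ≠ f p.2, (treeCount (G ⊔ edge p.1 p.2) : ℚ) =
      2 * (#(univ.image f) - 1) * treeCount G := by
  have hcount (p : V × V) (hp : f p.1 ≠ f p.2) : treeCount (G ⊔ edge p.1 p.2) =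
      ∑ T : SimpleGraph V with T.IsTree ∧ G ≤ T, if T.Adj p.1 p.2 then 1 else 0 := by
    have hne : p.1 ≠ p.2 := fun h ↦ hp (congrArg f h)
    rw [← card_filter, filter_filter, treeCount]
    congr 1
    ext T
    simp [sup_le_iff, hne, and_assoc]
  have hT (T : SimpleGraph V) (h : T.IsTree ∧ G ≤ T) :
      (#{p : V × V | f p.1 ≠ f p.2 ∧ T.Adj p.1 p.2} : ℚ) = 2 * (#(univ.image f) - 1) := by
    have : ((#{p : V × V | f p.1 ≠ f p.2 ∧ T.Adj p.1 p.2} + 2 : ℕ) : ℚ) = _ :=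
      congrArg _ (IsTree.card_adj_labels_ne hf hG h.1 h.2)
    push_cast at this
    linear_combination this
  calc
    _ = ((∑ p : V × V with f p.1 ≠ f p.2, ∑ T : SimpleGraph V with T.IsTree ∧ G ≤ T,
          if T.Adj p.1 p.2 then 1 else 0 : ℕ) : ℚ) := by
      rw [Nat.cast_sum]
      exact sum_congr rfl fun p hp ↦ congrArg _ (hcount p (mem_filter.1 hp).2)
    _ = ∑ T : SimpleGraph V with T.IsTree ∧ G ≤ T,
          (#{p : V × V | f p.1 ≠ f p.2 ∧ T.Adj p.1 p.2} : ℚ) := by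
      rw [sum_comm, Nat.cast_sum]
      refine sum_congr rfl fun T _ ↦ ?_
      rw [← card_filter, filter_filter]
    _ = _ := by
      rw [sum_congr rfl fun T hT' ↦ hT T (mem_filter.1 hT').2, sum_const, nsmul_eq_mul, treeCount]
      ring

lemma LabelsComponents.isTree [Nonempty V] {G : SimpleGraph V} {f : V → ι}
    (hf : G.LabelsComponents f) (hG : G.edgeSet.ncard + #(univ.image f) = Fintype.card V)
    (h1 : #(univ.image f) = 1) : G.IsTree := by
  refine isTree_iff_connected_and_card.2 ⟨⟨fun u v ↦ (hf u v).2 ?_⟩, ?_⟩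
  · exact card_le_one.1 h1.le _ (mem_image_of_mem f (mem_univ u)) _
      (mem_image_of_mem f (mem_univ v))
  · simpa [h1, Nat.card_eq_fintype_card] using hG

lemma IsTree.treeCount_eq_one {G : SimpleGraph V} (hG : G.IsTree) : treeCount G = 1 := by
  classical
  rw [treeCount, card_eq_one]
  refine ⟨G, eq_singleton_iff_unique_mem.2 ⟨by simp [hG], fun T hT ↦ ?_⟩⟩
  obtain ⟨hT, hle⟩ := (mem_filter.1 hT).2
  have h1 := hT.ncard_edgeSet_add_one
  have h2 := hG.ncard_edgeSet_add_one
  exact (edgeSet_injective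
    (Set.eq_of_subset_of_ncard_le (edgeSet_mono hle) (by omega) (Set.toFinite _))).symm

/-- **Generalized Cayley formula**: the number of spanning trees of the complete graph on `n`
vertices containing a forest with components of sizes `q₁, …, qₘ` is `q₁ ⋯ qₘ * n ^ (m - 2)`. -/
theorem treeCount_mul_card_sq [Nonempty V] {G : SimpleGraph V} {f : V → ι}
    (hf : G.LabelsComponents f) (hG : G.edgeSet.ncard + #(univ.image f) = Fintype.card V) :
    treeCount G * Fintype.card V ^ 2 = labelWeight f := by
  obtain ⟨c, hc⟩ : ∃ c, #(univ.image f) = c + 1 :=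
    ⟨_, (Nat.succ_pred (card_ne_zero.2 (univ_nonempty.image f))).symm⟩
  induction c generalizing G f with
  | zero =>
    obtain ⟨i, hi⟩ := card_eq_one.1 hc
    have hall (w : V) : f w = i := by
      simpa [hi] using mem_image_of_mem f (mem_univ w)
    rw [(hf.isTree hG hc).treeCount_eq_one, labelWeight, hi, prod_singleton, labelCard]
    simp [hall, sq]
  | succ c ih =>
    have hstep (p : V × V) (hp : f p.1 ≠ f p.2) :
        (treeCount (G ⊔ edge p.1 p.2) : ℚ) * Fintype.card V ^ 2 =
          labelWeight (mergeLabel f (f p.1) (f p.2)) := by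
      have hcard : #(univ.image (mergeLabel f (f p.1) (f p.2))) = c + 1 := by
        rw [image_mergeLabel hp, card_erase_of_mem (mem_image_of_mem f (mem_univ _)), hc]
        rfl
      have hedge : (G ⊔ edge p.1 p.2).edgeSet.ncard = G.edgeSet.ncard + 1 := by
        classical
        have := G.card_edgeFinset_sup_edge (s := p.1) (t := p.2)
          (fun h ↦ hp ((hf _ _).1 h.reachable)) (fun h ↦ hp (congrArg f h))
        rwa [← Set.ncard_coe_finset, ← Set.ncard_coe_finset, coe_edgeFinset,
          coe_edgeFinset] at this
      exact_mod_cast ih (hf.sup_edge hp) (by omega) hcard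
    have h1 := sum_treeCount_sup_edge hf hG
    have h2 := sum_labelWeight_mergeLabel f
    rw [← sum_congr rfl fun p hp ↦ hstep p (mem_filter.1 hp).2, ← sum_mul, h1, hc] at h2
    push_cast at h2
    have hc0 : (2 * ((c : ℚ) + 1)) ≠ 0 := by positivity
    have : (treeCount G : ℚ) * Fintype.card V ^ 2 = labelWeight f :=
      mul_left_cancel₀ hc0 (by linear_combination h2)
    exact_mod_cast this

end Cayley

lemma ite_card_inter_add_mul_ite_subset {α : Type*} [DecidableEq α] {S : Finset α} {k : ℕ}
    (hS : #S = k + 1) (X : Finset α) :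
    (if k ≤ #(X ∩ S) then 1 else 0) + k * (if S ⊆ X then 1 else 0) =
      ∑ e ∈ S, if S.erase e ⊆ X then 1 else 0 := by
  have hX : #(S \ X) + #(X ∩ S) = k + 1 := by
    rw [inter_comm, card_sdiff_add_card_inter, hS]
  rw [← card_filter]
  by_cases hsub : S ⊆ X
  · rw [filter_true_of_mem fun e _ ↦ (erase_subset e S).trans hsub, if_pos hsub, hS,
      inter_eq_right.2 hsub, hS, if_pos (by omega)]
    omega
  rw [if_neg hsub]
  have hne : #(S \ X) ≠ 0 := by simpa [sdiff_eq_empty_iff_subset] using hsub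
  split_ifs with hk
  · obtain ⟨a, ha⟩ := card_eq_one.1 (show #(S \ X) = 1 by omega)
    have : S.filter (fun e ↦ S.erase e ⊆ X) = {a} := by
      ext e
      simp only [Finset.ext_iff, mem_sdiff, mem_singleton] at ha
      simp only [mem_filter, mem_singleton, subset_iff, mem_erase]
      grind
    simp [this]
  · rw [mul_zero, add_zero, eq_comm, card_eq_zero]
    refine filter_false_of_mem fun e he h ↦ ?_
    have := card_le_card (subset_inter h (erase_subset e S))
    rw [card_erase_of_mem he, hS] at this
    exact hk (by simpa using this)

open Classical in
/-- Inclusion–exclusion for the trees missing at most one edge of a graph with `k + 1` edges. -/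
lemma card_trees_add_mul_treeCount {V : Type*} [Fintype V] {F : SimpleGraph V} {k : ℕ}
    (hF : F.edgeSet.ncard = k + 1) :
    Nat.card {T : SimpleGraph V // T.IsTree ∧ k ≤ (T.edgeSet ∩ F.edgeSet).ncard} +
      k * treeCount F = ∑ e ∈ F.edgeFinset, treeCount (F.deleteEdges {e}) := by
  have hS : #F.edgeFinset = k + 1 := by rw [← hF, ← coe_edgeFinset, Set.ncard_coe_finset]
  have hle (T : SimpleGraph V) : F ≤ T ↔ F.edgeFinset ⊆ T.edgeFinset := by simp
  have hdel (T : SimpleGraph V) (e : Sym2 V) :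
      F.deleteEdges {e} ≤ T ↔ F.edgeFinset.erase e ⊆ T.edgeFinset := by
    rw [← edgeSet_subset_edgeSet, edgeSet_deleteEdges, ← coe_subset, coe_erase, coe_edgeFinset,
      coe_edgeFinset]
  have hinter (T : SimpleGraph V) :
      (T.edgeSet ∩ F.edgeSet).ncard = #(T.edgeFinset ∩ F.edgeFinset) := by
    rw [← Set.ncard_coe_finset, coe_inter, coe_edgeFinset, coe_edgeFinset]
  have hcount (P : SimpleGraph V → Prop) [DecidablePred P] : #{T : SimpleGraph V | T.IsTree ∧ P T} =
      ∑ T : SimpleGraph V with T.IsTree, if P T then 1 else 0 := by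
    rw [← card_filter, filter_filter]
  rw [Nat.card_eq_fintype_card, Fintype.card_subtype, hcount]
  unfold treeCount
  simp_rw [hcount]
  rw [sum_comm, mul_sum, ← sum_add_distrib]
  refine sum_congr rfl fun T _ ↦ ?_
  simp_rw [hle, hdel, hinter]
  exact ite_card_inter_add_mul_ite_subset hS _

section Cherries

variable {V : Type*} {m : ℕ}

open Classical in
/-- The map sending each of the vertices `x (i, 0)`, `x (i, 1)`, `x (i, 2)` to `x (i, 1)` and
fixing all others. -/
noncomputable def centre (x : Fin m × Fin 3 → V) (w : V) : V :=
  if h : ∃ p, x p = w then x (h.choose.1, 1) else w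

/-- The two ends of the `i`-th path. -/
def leaf (x : Fin m × Fin 3 → V) (q : Fin m × Bool) : V := x (q.1, cond q.2 2 0)

/-- The edges of the paths, indexed by their ends. -/
def cherryEdge (x : Fin m × Fin 3 → V) (q : Fin m × Bool) : Sym2 V := s(x (q.1, 1), leaf x q)

variable {x : Fin m × Fin 3 → V}

lemma exists_eq_leaf_or_eq_mid (x : Fin m × Fin 3 → V) (w : V) :
    (∃ q, w = leaf x q) ∨ (∃ i, w = x (i, 1)) ∨ ∀ p, x p ≠ w := by
  by_cases h : ∃ p, x p = w
  · obtain ⟨⟨i, j⟩, rfl⟩ := h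
    fin_cases j
    · exact .inl ⟨(i, false), rfl⟩
    · exact .inr (.inl ⟨i, rfl⟩)
    · exact .inl ⟨(i, true), rfl⟩
  · exact .inr (.inr (not_exists.1 h))

lemma centre_apply (hx : Function.Injective x) (p : Fin m × Fin 3) :
    centre x (x p) = x (p.1, 1) := by
  have h : ∃ p', x p' = x p := ⟨p, rfl⟩
  rw [centre, dif_pos h, hx h.choose_spec]

lemma centre_of_forall_ne {w : V} (hw : ∀ p, x p ≠ w) : centre x w = w :=
  dif_neg (not_exists.2 hw)

lemma centre_leaf (hx : Function.Injective x) (q : Fin m × Bool) :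
    centre x (leaf x q) = x (q.1, 1) := centre_apply hx _

lemma leaf_injective (hx : Function.Injective x) : Function.Injective (leaf x) := by
  rintro ⟨i, b⟩ ⟨i', b'⟩ h
  have := hx h
  cases b <;> cases b' <;> simp_all

lemma mid_ne_leaf (hx : Function.Injective x) (i : Fin m) (q : Fin m × Bool) :
    x (i, 1) ≠ leaf x q := by
  rintro h
  have := hx h
  rcases q with ⟨i', _ | _⟩ <;> simp at this

lemma centre_ne_leaf (hx : Function.Injective x) (w : V) (q : Fin m × Bool) :
    centre x w ≠ leaf x q := by
  rcases exists_eq_leaf_or_eq_mid x w with ⟨q', rfl⟩ | ⟨i, rfl⟩ | h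
  · rw [centre_leaf hx]; exact mid_ne_leaf hx _ _
  · rw [centre_apply hx]; exact mid_ne_leaf hx _ _
  · rw [centre_of_forall_ne h]; exact (h _).symm

lemma cherryEdge_injective (hx : Function.Injective x) : Function.Injective (cherryEdge x) := by
  intro q q' h
  rcases Sym2.eq_iff.1 h with h | h
  · exact leaf_injective hx h.2
  · exact absurd h.1 (mid_ne_leaf hx _ _)

variable {F : SimpleGraph V}

lemma labelsComponents_centre (hx : Function.Injective x)
    (hF : F.edgeSet = Set.range (cherryEdge x)) : F.LabelsComponents (centre x) := by
  refine labelsComponents_of_rep (fun a b h ↦ ?_) fun w ↦ ?_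
  · obtain ⟨q, hq⟩ := hF ▸ (mem_edgeSet F).2 h
    rcases Sym2.eq_iff.1 hq with ⟨rfl, rfl⟩ | ⟨rfl, rfl⟩ <;> simp [centre_leaf hx, centre_apply hx]
  · rcases exists_eq_leaf_or_eq_mid x w with ⟨q, rfl⟩ | ⟨i, rfl⟩ | h
    · rw [centre_leaf hx]
      exact (Adj.reachable ((mem_edgeSet F).1 (hF ▸ ⟨q, rfl⟩))).symm
    · rw [centre_apply hx]
    · rw [centre_of_forall_ne h]

lemma ncard_edgeSet_cherries (hx : Function.Injective x)
    (hF : F.edgeSet = Set.range (cherryEdge x)) : F.edgeSet.ncard = 2 * m := by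
  rw [hF, ← Set.image_univ, Set.ncard_image_of_injective _ (cherryEdge_injective hx),
    Set.ncard_univ]
  simp [mul_comm]

variable [DecidableEq V]

lemma mergeLabel_update_centre (hx : Function.Injective x) {q : Fin m × Bool} :
    mergeLabel (Function.update (centre x) (leaf x q) (leaf x q)) (x (q.1, 1)) (leaf x q) =
      centre x := by
  funext w
  by_cases hw : w = leaf x q
  · subst hw
    simp [mergeLabel, centre_leaf hx]
  · simp [mergeLabel, Function.update_of_ne hw, centre_ne_leaf hx]

lemma labelsComponents_update_centre (hx : Function.Injective x)
    (hF : F.edgeSet = Set.range (cherryEdge x)) (q : Fin m × Bool) :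
    (F.deleteEdges {cherryEdge x q}).LabelsComponents
      (Function.update (centre x) (leaf x q) (leaf x q)) := by
  have hedge (e : Sym2 V) : e ∈ (F.deleteEdges {cherryEdge x q}).edgeSet ↔
      ∃ q' ≠ q, cherryEdge x q' = e := by
    rw [edgeSet_deleteEdges, hF]
    constructor
    · rintro ⟨⟨q', rfl⟩, h⟩
      exact ⟨q', fun h' ↦ h (h' ▸ rfl), rfl⟩
    · rintro ⟨q', h, rfl⟩
      exact ⟨⟨q', rfl⟩, fun h' ↦ h (cherryEdge_injective hx h')⟩
  refine labelsComponents_of_rep (fun a b h ↦ ?_) fun w ↦ ?_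
  · obtain ⟨q', hne, hq⟩ := (hedge _).1 ((mem_edgeSet _).2 h)
    have h1 := mid_ne_leaf hx q'.1 q
    have h2 := (leaf_injective hx).ne hne
    rcases Sym2.eq_iff.1 hq with ⟨rfl, rfl⟩ | ⟨rfl, rfl⟩ <;>
      simp [centre_leaf hx, centre_apply hx, Function.update_of_ne h1, Function.update_of_ne h2]
  · by_cases hw : w = leaf x q
    · subst hw; simp
    rw [Function.update_of_ne hw]
    rcases exists_eq_leaf_or_eq_mid x w with ⟨q', rfl⟩ | ⟨i, rfl⟩ | h
    · rw [centre_leaf hx]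
      have hne : q' ≠ q := fun h ↦ hw (h ▸ rfl)
      exact (Adj.reachable ((mem_edgeSet _).1 ((hedge _).2 ⟨q', hne, rfl⟩))).symm
    · rw [centre_apply hx]
    · rw [centre_of_forall_ne h]

variable [Fintype V]

lemma card_image_centre (hx : Function.Injective x) :
    2 * m + #(univ.image (centre x)) = Fintype.card V := by
  have hcompl : univ.image (centre x) = (univ.image (leaf x))ᶜ := by
    ext w
    simp only [mem_image, mem_univ, true_and, mem_compl, not_exists]
    constructor
    · rintro ⟨w, rfl⟩ q h
      exact centre_ne_leaf hx w q h.symm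
    · intro hw
      rcases exists_eq_leaf_or_eq_mid x w with ⟨q, rfl⟩ | ⟨i, rfl⟩ | h
      · exact absurd rfl (hw q)
      · exact ⟨_, centre_apply hx (i, 1)⟩
      · exact ⟨w, centre_of_forall_ne h⟩
  have := card_add_card_compl (univ.image (leaf x))
  rw [← hcompl, card_image_of_injective _ (leaf_injective hx)] at this
  simpa [mul_comm] using this

lemma labelCard_centre_mid (hx : Function.Injective x) (i : Fin m) :
    labelCard (centre x) (x (i, 1)) = 3 := by
  have : ({w | centre x w = x (i, 1)} : Finset V) = univ.image fun j ↦ x (i, j) := by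
    ext w
    simp only [mem_filter, mem_univ, true_and, mem_image]
    constructor
    · intro h
      rcases exists_eq_leaf_or_eq_mid x w with ⟨q, rfl⟩ | ⟨i', rfl⟩ | h'
      · rw [centre_leaf hx] at h
        obtain rfl : q.1 = i := congrArg Prod.fst (hx h)
        exact ⟨_, rfl⟩
      · rw [centre_apply hx] at h
        exact ⟨1, h.symm⟩
      · exact absurd ((centre_of_forall_ne h').symm.trans h).symm (h' _)
    · rintro ⟨j, rfl⟩
      exact centre_apply hx _
  rw [labelCard, this, card_image_of_injective _ fun j j' h ↦ congrArg Prod.snd (hx h)]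
  simp

lemma labelCard_centre_of_forall_ne (hx : Function.Injective x) {v : V} (hv : ∀ p, x p ≠ v) :
    labelCard (centre x) v = 1 := by
  rw [labelCard, card_eq_one]
  refine ⟨v, ?_⟩
  ext w
  simp only [mem_filter, mem_univ, true_and, mem_singleton]
  refine ⟨fun h ↦ ?_, fun h ↦ h.symm ▸ centre_of_forall_ne hv⟩
  by_cases hw : ∃ p, x p = w
  · obtain ⟨p, rfl⟩ := hw
    exact absurd (centre_apply hx p ▸ h) (hv _)
  · exact (centre_of_forall_ne (not_exists.1 hw)).symm.trans h

lemma labelWeight_centre (hx : Function.Injective x) :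
    labelWeight (centre x) = Fintype.card V ^ #(univ.image (centre x)) * 3 ^ m := by
  rw [labelWeight, prod_mul_distrib, prod_const]
  congr 1
  have hinj : Function.Injective fun i : Fin m ↦ x (i, 1) :=
    fun i j h ↦ congrArg Prod.fst (hx h)
  have hsub : univ.image (fun i : Fin m ↦ x (i, 1)) ⊆ univ.image (centre x) := by
    intro w hw
    obtain ⟨i, -, rfl⟩ := mem_image.1 hw
    exact mem_image.2 ⟨x (i, 1), mem_univ _, centre_apply hx _⟩
  rw [← prod_subset hsub, prod_image hinj.injOn]
  · simp [labelCard_centre_mid hx]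
  · intro v hv hv'
    obtain ⟨w, -, rfl⟩ := mem_image.1 hv
    rcases exists_eq_leaf_or_eq_mid x (centre x w) with ⟨q, h⟩ | ⟨i, h⟩ | h
    · exact absurd h (centre_ne_leaf hx _ _)
    · exact absurd (mem_image.2 ⟨i, mem_univ _, h.symm⟩) hv'
    · exact labelCard_centre_of_forall_ne hx h

/-- The number of trees containing `m` disjoint paths on three vertices. -/
lemma treeCount_cherries [Nonempty V] (hx : Function.Injective x)
    (hF : F.edgeSet = Set.range (cherryEdge x)) (hm : 2 * m + 2 ≤ Fintype.card V) :
    treeCount F = Fintype.card V ^ (Fintype.card V - 2 * m - 2) * 3 ^ m := by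
  have hc := card_image_centre hx
  have h := treeCount_mul_card_sq (labelsComponents_centre hx hF)
    (ncard_edgeSet_cherries hx hF ▸ hc)
  rw [labelWeight_centre hx,
    show #(univ.image (centre x)) = (Fintype.card V - 2 * m - 2) + 2 by omega, pow_add] at h
  exact Nat.eq_of_mul_eq_mul_right (pow_pos Fintype.card_pos 2) (by rw [h]; ring)

lemma three_mul_treeCount_deleteEdges_cherryEdge [Nonempty V] (hx : Function.Injective x)
    (hF : F.edgeSet = Set.range (cherryEdge x)) (q : Fin m × Bool) :
    3 * treeCount (F.deleteEdges {cherryEdge x q}) = 2 * Fintype.card V * treeCount F := by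
  set g := Function.update (centre x) (leaf x q) (leaf x q) with hg
  have hu : g (x (q.1, 1)) = x (q.1, 1) := by
    rw [hg, Function.update_of_ne (mid_ne_leaf hx _ _), centre_apply hx]
  have hv : g (leaf x q) = leaf x q := by simp [hg]
  have hne : g (x (q.1, 1)) ≠ g (leaf x q) := by rw [hu, hv]; exact mid_ne_leaf hx _ _
  have hmerge : mergeLabel g (g (x (q.1, 1))) (g (leaf x q)) = centre x := by
    rw [hu, hv]; exact mergeLabel_update_centre hx
  have hcard_leaf : labelCard g (leaf x q) = 1 := by
    rw [labelCard, card_eq_one]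
    refine ⟨leaf x q, ?_⟩
    ext w
    by_cases hw : w = leaf x q
    · simp [hw, hv]
    · simp [hw, hg, centre_ne_leaf hx]
  have hcard_mid : labelCard g (x (q.1, 1)) = 2 := by
    have := labelCard_mergeLabel_left (f := g) hne
    rw [hmerge, hu, hv, hcard_leaf, labelCard_centre_mid hx] at this
    omega
  have himage : #(univ.image (centre x)) + 1 = #(univ.image g) := by
    rw [← hmerge, image_mergeLabel hne, card_erase_add_one (mem_image_of_mem g (mem_univ _))]
  have hedges : (F.deleteEdges {cherryEdge x q}).edgeSet.ncard + 1 = 2 * m := by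
    rw [edgeSet_deleteEdges, Set.ncard_sdiff_singleton_add_one (hF ▸ ⟨q, rfl⟩) (Set.toFinite _),
      ncard_edgeSet_cherries hx hF]
  have hc := card_image_centre hx
  have hcountF := treeCount_mul_card_sq (labelsComponents_centre hx hF)
    (ncard_edgeSet_cherries hx hF ▸ hc)
  have hcountD := treeCount_mul_card_sq (labelsComponents_update_centre hx hF q)
    (by rw [← hg]; omega)
  have hweight := labelWeight_mergeLabel hne
  rw [hmerge, hu, hv, hcard_leaf, hcard_mid, ← hcountF, ← hcountD] at hweight
  exact Nat.eq_of_mul_eq_mul_right (pow_pos Fintype.card_pos 2) (by linarith)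

end Cherries

end SimpleGraph

open SimpleGraph in
/-- Let `n ≥ 8` and `t` even with `3(t+2)/2 ≤ n`. If `F` is a disjoint union of `t/2 + 1`
paths on `3` vertices (so `F` has `t + 2` edges), then the number of spanning trees of
`K_n` containing at least `t + 1` edges of `F` equals
`3^(t/2) · n^(n-t-4) · (2nt + 4n - 3t - 3)`. -/
theorem count_trees_with_most_path_edges (n t : ℕ) (hn : 8 ≤ n) (ht : 2 ∣ t)
    (hsize : 3 * (t + 2) ≤ 2 * n)
    (x : Fin (t / 2 + 1) × Fin 3 → Fin n) (hx : Function.Injective x)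
    (F : SimpleGraph (Fin n))
    (hF : ∀ a b : Fin n, F.Adj a b ↔ ∃ i : Fin (t / 2 + 1),
      (a = x (i, 0) ∧ b = x (i, 1)) ∨ (a = x (i, 1) ∧ b = x (i, 0)) ∨
      (a = x (i, 1) ∧ b = x (i, 2)) ∨ (a = x (i, 2) ∧ b = x (i, 1))) :
    Nat.card {T : SimpleGraph (Fin n) // T.IsTree ∧ t + 1 ≤ (T.edgeSet ∩ F.edgeSet).ncard}
      = 3 ^ (t / 2) * n ^ (n - t - 4) * (2 * n * t + 4 * n - 3 * t - 3) := by
  classical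
  have : Nonempty (Fin n) := ⟨⟨0, by omega⟩⟩
  obtain ⟨s, rfl⟩ := ht
  have hs : 2 * s / 2 = s := by omega
  have hrange : F.edgeSet = Set.range (cherryEdge x) := by
    ext e
    induction e with | _ a b
    rw [mem_edgeSet, hF]
    simp only [Set.mem_range, Prod.exists, Bool.exists_bool, cherryEdge, leaf, cond_true,
      cond_false, Sym2.eq_iff]
    grind
  have hedges := ncard_edgeSet_cherries hx hrange
  have hF_count := treeCount_cherries hx hrange (by simp only [Fintype.card_fin]; omega)
  have hmain := card_trees_add_mul_treeCount (F := F) (k := 2 * s + 1) (by omega)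
  have hsum : 3 * ∑ e ∈ F.edgeFinset, treeCount (F.deleteEdges {e}) =
      (2 * s + 2) * (2 * n * treeCount F) := by
    have hcard : #F.edgeFinset = 2 * s + 2 := by
      rw [← Set.ncard_coe_finset, coe_edgeFinset]; omega
    rw [mul_sum, sum_const_nat (m := 2 * n * treeCount F), hcard]
    intro e he
    obtain ⟨q, rfl⟩ := hrange ▸ mem_edgeFinset.1 he
    simpa using three_mul_treeCount_deleteEdges_cherryEdge hx hrange q
  rw [← hmain] at hsum
  rw [hs, Fintype.card_fin, show n - 2 * (s + 1) - 2 = n - 2 * s - 4 by omega, pow_succ]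
    at hF_count
  rw [hs]
  generalize Nat.card _ = A at hsum ⊢
  have hle : 3 * (2 * s) ≤ 2 * n * (2 * s) := by gcongr; omega
  obtain ⟨d, hd⟩ := Nat.exists_eq_add_of_le
    (show 3 * (2 * s) + 3 ≤ 2 * n * (2 * s) + 4 * n by omega)
  rw [show 2 * n * (2 * s) + 4 * n - 3 * (2 * s) - 3 = d by omega]
  rw [hF_count] at hsum
  refine Nat.eq_of_mul_eq_mul_left three_pos ?_
  zify at hsum hd ⊢
  linear_combination hsum + 3 * (3 ^ s * (n : ℤ) ^ (n - 2 * s - 4)) * hd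
end
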